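/- arXiv:2004.09543 — 6 statements merged into one kernel-verified Lean document; each statement's English description precedes it below -/
import Mathlib

section
/- Let p : Fin 4 → ℝ be a vector, let η be the Minkowski metric, set p_μ := Σ_ν η μ ν * p ν (lowered index) and p² := Σ_μ p μ * p_μ, and assume p² ≠ 0. Let ζ : ℝ with ζ ≠ 0, and let I denote the imaginary unit in ℂ. Define the quadratic graviton vertex G₂ : Fin 4 → Fin 4 → Fin 4 → Fin 4 → ℂ by G₂ μ₁ ν₁ μ₂ ν₂ := (I/4)·(1 − 1/ζ)·(p μ₁ · p ν₁ · η μ₂ ν₂ + p μ₂ · p ν₂ · η μ₁ ν₁) − (I/8)·(1 − 1/ζ)·(p μ₁ · p μ₂ · η ν₁ ν₂ + p μ₁ · p ν₂ · η ν₁ μ₂ + p ν₁ · p μ₂ · η μ₁ ν₂ + p ν₁ · p ν₂ · η μ₁ μ₂) − (I/4)·(1 − 1/(2ζ))·p²·η μ₁ ν₁ · η μ₂ ν₂ + (I/8)·p²·(η μ₁ μ₂ · η ν₁ ν₂ + η μ₁ ν₂ · η ν₁ μ₂), and define the graviton propagator P : Fin 4 → Fin 4 → Fin 4 → Fin 4 →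 ℂ by P μ₁ ν₁ μ₂ ν₂ := −(2·I/p²)·((η μ₁ μ₂ · η ν₁ ν₂ + η μ₁ ν₂ · η ν₁ μ₂ − η μ₁ ν₁ · η μ₂ ν₂) − ((1 − ζ)/p²)·(η μ₁ μ₂ · p_ν₁ · p_ν₂ + η μ₁ ν₂ · p_ν₁ · p_μ₂ + η ν₁ μ₂ · p_μ₁ · p_ν₂ + η ν₁ ν₂ · p_μ₁ · p_μ₂)). Then for all μ₁, ν₁, μ₃, ν₃ in Fin 4: Σ_{μ₂ ∈ Fin 4} Σ_{ν₂ ∈ Fin 4} P μ₁ ν₁ μ₂ ν₂ * G₂ μ₂ ν₂ μ₃ ν₃ = (1/2)·(δ μ₁ μ₃ · δ ν₁ ν₃ + δ μ₁ ν₃ · δ ν₁ μ₃), where δ a b is 1 if a = b and 0 otherwise. -/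
open BigOperators

/-- The Minkowski metric `diag(1, -1, -1, -1)`. -/
noncomputable def minkowski : Matrix (Fin 4) (Fin 4) ℝ :=
  Matrix.diagonal ![1, -1, -1, -1]

section Contraction

variable {p l : Fin 4 → ℂ} {s : ℂ}

/-- The Kronecker delta with complex values. -/
noncomputable def kron (a b : Fin 4) : ℂ := if a = b then 1 else 0

/-- The diagonal entries of the Minkowski metric, as complex numbers. -/
noncomputable def sgn (a : Fin 4) : ℂ := ((![1, -1, -1, -1] : Fin 4 → ℝ) a : ℂ)

lemma sgn_mul_self (a : Fin 4) : sgn a * sgn a = 1 := by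
  fin_cases a <;> simp [sgn]

lemma minkowski_eq (a b : Fin 4) : (minkowski a b : ℂ) = sgn a * kron a b := by
  by_cases h : a = b <;> simp [minkowski, sgn, kron, h]

lemma kron_comm (a b : Fin 4) : kron a b = kron b a := by
  simp [kron, eq_comm]

lemma sum_kron (a : Fin 4) (f : Fin 4 → ℂ) : ∑ x, kron a x * f x = f a := by
  simp [kron]

lemma sgn_mul_kron (a b : Fin 4) : sgn a * kron a b = sgn b * kron a b := by
  by_cases h : a = b <;> simp [kron, h]

lemma minkowski_comm (a b : Fin 4) : (minkowski a b : ℂ) = minkowski b a := by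
  rw [minkowski_eq, minkowski_eq, sgn_mul_kron, kron_comm]

lemma sgn_mul_minkowski (a b : Fin 4) : sgn a * (minkowski a b : ℂ) = kron a b := by
  rw [minkowski_eq, ← mul_assoc, sgn_mul_self, one_mul]

lemma sgn_mul_sgn_mul_minkowski (a b : Fin 4) :
    sgn a * sgn b * (minkowski a b : ℂ) = minkowski a b := by
  rw [mul_right_comm, sgn_mul_minkowski, minkowski_eq, sgn_mul_kron, mul_comm]

lemma sum_minkowski (a : Fin 4) (f : Fin 4 → ℂ) :
    ∑ x, (minkowski a x : ℂ) * f x = sgn a * f a := by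
  simp only [minkowski_eq, mul_assoc, ← Finset.mul_sum, sum_kron]

lemma sum_lower_mul (hl : ∀ a, l a = sgn a * p a) (hs : s = ∑ a, p a * l a)
    (A B C D : ℂ) (a c f : Fin 4) :
    ∑ y, l y * (A * p y + B * (minkowski c y : ℂ) + C * (minkowski f y : ℂ)
      + D * (minkowski a y : ℂ)) = A * s + B * p c + C * p f + D * p a := by
  have h (b : Fin 4) : ∑ y, (minkowski b y : ℂ) * l y = p b := by
    rw [sum_minkowski, hl, ← mul_assoc, sgn_mul_self, one_mul]
  rw [hs, ← h c, ← h f, ← h a]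
  simp only [Finset.mul_sum, ← Finset.sum_add_distrib]
  exact Finset.sum_congr rfl fun y _ => by ring

lemma sum_trace (hl : ∀ a, l a = sgn a * p a) (hs : s = ∑ a, p a * l a)
    (A B C D E : ℂ) (c f : Fin 4) :
    ∑ x, sgn x * (A * (p x * p x) + B * (minkowski x x : ℂ) + C * (p x * (minkowski c x : ℂ))
      + D * (p x * (minkowski f x : ℂ)) + E * ((minkowski c x : ℂ) * (minkowski f x : ℂ)))
      = A * s + 4 * B + C * p c + D * p f + E * (minkowski c f : ℂ) := by
  have h (b : Fin 4) : ∑ y, (minkowski b y : ℂ) * (sgn y * p y) = p b := by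
    rw [sum_minkowski, ← mul_assoc, sgn_mul_self, one_mul]
  have h4 : (4 : ℂ) = ∑ x, sgn x * (minkowski x x : ℂ) := by
    simp [sgn_mul_minkowski, kron]
  have h2 : (minkowski c f : ℂ) = ∑ x, (minkowski c x : ℂ) * (sgn x * (minkowski f x : ℂ)) := by
    rw [sum_minkowski, ← mul_assoc, sgn_mul_self, one_mul, minkowski_comm]
  rw [h2, h4, hs, ← h c, ← h f]
  simp only [hl, Finset.mul_sum, Finset.sum_mul, ← Finset.sum_add_distrib]
  exact Finset.sum_congr rfl fun y _ => by ring

lemma sum_propagator_mul (k z : ℂ) (a b : Fin 4) (T : Fin 4 → Fin 4 → ℂ) :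
    ∑ x, ∑ y, k * (((minkowski a x : ℂ) * (minkowski b y : ℂ)
        + (minkowski a y : ℂ) * (minkowski b x : ℂ)
        - (minkowski a b : ℂ) * (minkowski x y : ℂ))
      - z * ((minkowski a x : ℂ) * l b * l y + (minkowski a y : ℂ) * l b * l x
        + (minkowski b x : ℂ) * l a * l y + (minkowski b y : ℂ) * l a * l x)) * T x y
      = k * ((sgn a * sgn b * T a b + sgn b * sgn a * T b a
          - (minkowski a b : ℂ) * ∑ x, sgn x * T x x)
        - z * (l b * (sgn a * ∑ y, l y * T a y) + l b * (sgn a * ∑ x, l x * T x a)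
          + l a * (sgn b * ∑ y, l y * T b y) + l a * (sgn b * ∑ x, l x * T x b))) := by
  have h1 (a b : Fin 4) (U : Fin 4 → Fin 4 → ℂ) : sgn a * sgn b * U a b
      = ∑ x, ∑ y, (minkowski a x : ℂ) * ((minkowski b y : ℂ) * U x y) := by
    simp only [← Finset.mul_sum, sum_minkowski]
    ring
  have h2 : ∑ x, sgn x * T x x = ∑ x, ∑ y, (minkowski x y : ℂ) * T x y := by
    simp only [sum_minkowski]
  have h3 (a : Fin 4) : sgn a * ∑ y, l y * T a y
      = ∑ x, ∑ y, (minkowski a x : ℂ) * (l y * T x y) := by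
    simp only [← Finset.mul_sum, sum_minkowski]
  have h4 (a : Fin 4) : sgn a * ∑ x, l x * T x a
      = ∑ x, ∑ y, (minkowski a y : ℂ) * (l x * T x y) := by
    rw [Finset.sum_comm]
    simp only [← Finset.mul_sum, sum_minkowski]
  rw [h1 a b T, h2, h3, h3, h4, h4, mul_comm (sgn b) (sgn a), h1 a b fun x y => T y x,
    Finset.sum_comm (f := fun x y => (minkowski a x : ℂ) * ((minkowski b y : ℂ) * T y x))]
  simp only [Finset.mul_sum, ← Finset.sum_add_distrib, ← Finset.sum_sub_distrib]
  exact Finset.sum_congr rfl fun x _ => Finset.sum_congr rfl fun y _ => by ring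

end Contraction

/-- The graviton propagator Feynman rule inverts the quadratic graviton vertex Feynman rule
of (effective) Quantum General Relativity with linearized de Donder gauge fixing and general
gauge parameter ζ. -/
theorem graviton_propagator_inverts_vertex
    (p : Fin 4 → ℝ)
    (plow : Fin 4 → ℝ) (hplow : ∀ μ, plow μ = ∑ ν, minkowski μ ν * p ν)
    (psq : ℝ) (hpsq : psq = ∑ μ, p μ * plow μ) (hp : psq ≠ 0)
    (ζ : ℝ) (hζ : ζ ≠ 0)
    (G₂ : Fin 4 → Fin 4 → Fin 4 → Fin 4 → ℂ)
    (hG : ∀ μ₁ ν₁ μ₂ ν₂, G₂ μ₁ ν₁ μ₂ ν₂ =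
      (Complex.I / 4) * (1 - 1 / (ζ : ℂ)) *
        ((p μ₁ : ℂ) * (p ν₁ : ℂ) * (minkowski μ₂ ν₂ : ℂ)
          + (p μ₂ : ℂ) * (p ν₂ : ℂ) * (minkowski μ₁ ν₁ : ℂ))
      - (Complex.I / 8) * (1 - 1 / (ζ : ℂ)) *
        ((p μ₁ : ℂ) * (p μ₂ : ℂ) * (minkowski ν₁ ν₂ : ℂ)
          + (p μ₁ : ℂ) * (p ν₂ : ℂ) * (minkowski ν₁ μ₂ : ℂ)
          + (p ν₁ : ℂ) * (p μ₂ : ℂ) * (minkowski μ₁ ν₂ : ℂ)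
          + (p ν₁ : ℂ) * (p ν₂ : ℂ) * (minkowski μ₁ μ₂ : ℂ))
      - (Complex.I / 4) * (1 - 1 / (2 * (ζ : ℂ))) *
        ((psq : ℂ) * (minkowski μ₁ ν₁ : ℂ) * (minkowski μ₂ ν₂ : ℂ))
      + (Complex.I / 8) *
        ((psq : ℂ) * (minkowski μ₁ μ₂ : ℂ) * (minkowski ν₁ ν₂ : ℂ)
          + (psq : ℂ) * (minkowski μ₁ ν₂ : ℂ) * (minkowski ν₁ μ₂ : ℂ)))
    (P : Fin 4 → Fin 4 → Fin 4 → Fin 4 → ℂ)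
    (hP : ∀ μ₁ ν₁ μ₂ ν₂, P μ₁ ν₁ μ₂ ν₂ =
      -(2 * Complex.I / (psq : ℂ)) *
        (((minkowski μ₁ μ₂ : ℂ) * (minkowski ν₁ ν₂ : ℂ)
            + (minkowski μ₁ ν₂ : ℂ) * (minkowski ν₁ μ₂ : ℂ)
            - (minkowski μ₁ ν₁ : ℂ) * (minkowski μ₂ ν₂ : ℂ))
          - ((1 - (ζ : ℂ)) / (psq : ℂ)) *
            ((minkowski μ₁ μ₂ : ℂ) * (plow ν₁ : ℂ) * (plow ν₂ : ℂ)
              + (minkowski μ₁ ν₂ : ℂ) * (plow ν₁ : ℂ) * (plow μ₂ : ℂ)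
              + (minkowski ν₁ μ₂ : ℂ) * (plow μ₁ : ℂ) * (plow ν₂ : ℂ)
              + (minkowski ν₁ ν₂ : ℂ) * (plow μ₁ : ℂ) * (plow μ₂ : ℂ)))) :
    ∀ μ₁ ν₁ μ₃ ν₃, ∑ μ₂, ∑ ν₂, P μ₁ ν₁ μ₂ ν₂ * G₂ μ₂ ν₂ μ₃ ν₃ =
      (1 / 2 : ℂ) * ((if μ₁ = μ₃ then (1 : ℂ) else 0) * (if ν₁ = ν₃ then (1 : ℂ) else 0)
        + (if μ₁ = ν₃ then (1 : ℂ) else 0) * (if ν₁ = μ₃ then (1 : ℂ) else 0)) := by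
  intro a b c f
  have hl (x : Fin 4) : (plow x : ℂ) = sgn x * (p x : ℂ) := by
    rw [hplow]
    push_cast
    exact sum_minkowski x fun y => (p y : ℂ)
  have hs : (psq : ℂ) = ∑ x, (p x : ℂ) * (plow x : ℂ) := by
    rw [hpsq]
    push_cast
    rfl
  have hp' : (psq : ℂ) ≠ 0 := by exact_mod_cast hp
  have hζ' : (ζ : ℂ) ≠ 0 := by exact_mod_cast hζ
  have hsymm (x y : Fin 4) : G₂ x y c f = G₂ y x c f := by
    rw [hG, hG, minkowski_comm y x]
    ring
  have hdiv (x : Fin 4) : sgn x * ∑ y, (plow y : ℂ) * G₂ x y c f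
      = Complex.I * psq / (8 * ζ) *
        (p c * kron x f + p f * kron x c - plow x * (minkowski c f : ℂ)) := by
    have h := sum_lower_mul hl hs
      (Complex.I / 4 * (1 - 1 / (ζ : ℂ)) * (p x * (minkowski c f : ℂ))
        - Complex.I / 8 * (1 - 1 / (ζ : ℂ)) *
          (p c * (minkowski x f : ℂ) + p f * (minkowski x c : ℂ)))
      (-(Complex.I / 8 * (1 - 1 / (ζ : ℂ)) * (p x * p f))
        + Complex.I / 8 * (psq * (minkowski x f : ℂ)))
      (-(Complex.I / 8 * (1 - 1 / (ζ : ℂ)) * (p x * p c))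
        + Complex.I / 8 * (psq * (minkowski x c : ℂ)))
      (Complex.I / 4 * (1 - 1 / (ζ : ℂ)) * (p c * p f)
        - Complex.I / 4 * (1 - 1 / (2 * (ζ : ℂ))) * (psq * (minkowski c f : ℂ))) x c f
    rw [Finset.sum_congr rfl fun y _ => by
      rw [hG, minkowski_comm y c, minkowski_comm y f], hl, ← sgn_mul_minkowski,
      ← sgn_mul_minkowski]
    refine Eq.trans (congrArg _ (Eq.trans (Finset.sum_congr rfl fun y _ => ?_) h)) ?_
    · ring
    · field_simp
      ring
  have hdiv' (x : Fin 4) : ∑ y, (plow y : ℂ) * G₂ y x c f = ∑ y, (plow y : ℂ) * G₂ x y c f :=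
    Finset.sum_congr rfl fun y _ => by rw [hsymm]
  have htrace : ∑ x, sgn x * G₂ x x c f
      = Complex.I / 2 * (1 - 1 / (ζ : ℂ)) * (p c * p f)
        + Complex.I / 4 * (1 / (ζ : ℂ) - 2) * (psq * (minkowski c f : ℂ)) := by
    have h := sum_trace hl hs
      (Complex.I / 4 * (1 - 1 / (ζ : ℂ)) * (minkowski c f : ℂ))
      (Complex.I / 4 * (1 - 1 / (ζ : ℂ)) * (p c * p f)
        - Complex.I / 4 * (1 - 1 / (2 * (ζ : ℂ))) * (psq * (minkowski c f : ℂ)))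
      (-(Complex.I / 4 * (1 - 1 / (ζ : ℂ)) * p f))
      (-(Complex.I / 4 * (1 - 1 / (ζ : ℂ)) * p c))
      (Complex.I / 4 * psq) c f
    refine Eq.trans (Finset.sum_congr rfl fun x _ => ?_) (h.trans ?_)
    · rw [hG, minkowski_comm x c, minkowski_comm x f]
      ring
    · field_simp
      ring
  have hlow : sgn a * sgn b * G₂ a b c f
      = Complex.I / 4 * (1 - 1 / (ζ : ℂ)) *
          (plow a * plow b * (minkowski c f : ℂ) + p c * p f * (minkowski a b : ℂ))
        - Complex.I / 8 * (1 - 1 / (ζ : ℂ)) *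
          (plow a * p c * kron b f + plow a * p f * kron b c
            + plow b * p c * kron a f + plow b * p f * kron a c)
        - Complex.I / 4 * (1 - 1 / (2 * (ζ : ℂ))) *
          (psq * (minkowski a b : ℂ) * (minkowski c f : ℂ))
        + Complex.I / 8 * (psq * kron a c * kron b f + psq * kron a f * kron b c) := by
    rw [hG]
    simp only [hl, ← sgn_mul_minkowski]
    linear_combination
      (Complex.I / 4 * (1 - 1 / (ζ : ℂ)) * (p c * p f)
        - Complex.I / 4 * (1 - 1 / (2 * (ζ : ℂ))) * (psq * (minkowski c f : ℂ)))
        * sgn_mul_sgn_mul_minkowski a b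
  simp only [hP]
  refine (sum_propagator_mul (l := fun x => (plow x : ℂ)) _ _ a b fun x y => G₂ x y c f).trans ?_
  rw [htrace, hdiv', hdiv', hdiv, hdiv, mul_comm (sgn b) (sgn a),
    hsymm b a, hlow]
  change _ = (1 / 2 : ℂ) * (kron a c * kron b f + kron a f * kron b c)
  field_simp
  ring_nf
  simp only [Complex.I_sq]
  ring
end

section
/- Let η be the Minkowski metric, let h ∈ Matrix (Fin 4) (Fin 4) ℝ with hᵀ = h, and let κ : ℝ. Equip Matrix (Fin 4) (Fin 4) ℝ with the L∞-operator norm. Assume |κ| * ‖h * η‖ < 1 and |κ| * ‖η * h‖ < 1. Then the series E := Σ_{k=0}^∞ (binom (1/2) k * κ^k) • (h * η)^k and F := Σ_{k=0}^∞ (binom (−1/2) k * κ^k) • (η * h)^k both converge, and their sums satisfy: (i) E * η * Eᵀ = η + κ • h, and (ii) (η + κ • h) * (F * η * Fᵀ) = 1, i.e. F * η * Fᵀ is the inverse of η + κ • h. -/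
open BigOperators Matrix

attribute [local instance] Matrix.linftyOpNormedRing Matrix.linftyOpNormedAlgebra

/-- The generalized binomial coefficient `binom r k = r(r-1)⋯(r-k+1)/k!`. -/
noncomputable def gbinom (r : ℝ) (k : ℕ) : ℝ :=
  (∏ i ∈ Finset.range k, (r - i)) / (k.factorial : ℝ)

theorem gbinom_eq_choose (r : ℝ) (k : ℕ) : gbinom r k = Ring.choose r k := by
  rw [Ring.choose_eq_smul, ← Polynomial.aeval_eq_smeval, ← Polynomial.eval_map_algebraMap,
    descPochhammer_map, descPochhammer_eval_eq_prod_range, gbinom, smul_eq_mul, div_eq_inv_mul]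

section BinomialSum

variable {A : Type*} [NormedRing A] [NormedAlgebra ℝ A]

/-- The binomial series `∑ binom(r, k) x ^ k`, representing `(1 + x) ^ r` for `‖x‖ < 1`. -/
noncomputable def binomialSum (r : ℝ) (x : A) : A :=
  ∑' k : ℕ, Ring.choose r k • x ^ k

theorem binomialSum_zero (x : A) : binomialSum 0 x = 1 := by
  rw [binomialSum, tsum_eq_single 0 fun k hk => by
    rw [Ring.choose_zero_pos ℝ (Nat.pos_of_ne_zero hk), zero_smul]]
  simp

theorem binomialSum_one (x : A) : binomialSum 1 x = 1 + x := by
  have hchoose (k : ℕ) : Ring.choose (1 : ℝ) k = (Nat.choose 1 k : ℝ) := by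
    exact_mod_cast Ring.choose_natCast (R := ℝ) 1 k
  rw [binomialSum, tsum_eq_sum (s := Finset.range 2) fun k hk => by
    rw [hchoose, Nat.choose_eq_zero_of_lt (by simpa using hk), Nat.cast_zero, zero_smul]]
  simp [Finset.sum_range_succ]

variable [NormOneClass A]

theorem summable_norm_choose_smul_pow (r : ℝ) {x : A} (hx : ‖x‖ < 1) :
    Summable fun k : ℕ => ‖Ring.choose r k • x ^ k‖ := by
  have hr : ((‖x‖₊ : NNReal) : ENNReal) < (binomialSeries ℝ r).radius :=
    lt_of_lt_of_le (by exact_mod_cast hx) binomialSeries_radius_ge_one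
  refine ((binomialSeries ℝ r).summable_norm_mul_pow hr).of_nonneg_of_le
    (fun _ => norm_nonneg _) fun k => ?_
  rw [norm_smul, binomialSeries, FormalMultilinearSeries.ofScalars_norm, coe_nnnorm]
  gcongr
  exact norm_pow_le x k

variable [CompleteSpace A]

theorem hasSum_binomialSum (r : ℝ) {x : A} (hx : ‖x‖ < 1) :
    HasSum (fun k : ℕ => Ring.choose r k • x ^ k) (binomialSum r x) :=
  (summable_norm_choose_smul_pow r hx).of_norm.hasSum

theorem binomialSum_add (r s : ℝ) {x : A} (hx : ‖x‖ < 1) :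
    binomialSum (r + s) x = binomialSum r x * binomialSum s x := by
  rw [binomialSum, binomialSum, binomialSum,
    tsum_mul_tsum_eq_tsum_sum_antidiagonal_of_summable_norm
      (summable_norm_choose_smul_pow r hx) (summable_norm_choose_smul_pow s hx)]
  refine tsum_congr fun n => ?_
  rw [Ring.add_choose_eq n (Commute.all r s), Finset.sum_smul]
  refine Finset.sum_congr rfl fun ij hij => ?_
  rw [smul_mul_smul_comm, ← pow_add, Finset.HasAntidiagonal.mem_antidiagonal.mp hij]

end BinomialSum

theorem SemiconjBy.binomialSum {A : Type*} [NormedRing A] [NormOneClass A] [NormedAlgebra ℝ A]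
    [CompleteSpace A] (r : ℝ) {a x y : A} (hx : ‖x‖ < 1) (hy : ‖y‖ < 1) (h : SemiconjBy a x y) :
    SemiconjBy a (binomialSum r x) (binomialSum r y) := by
  refine ((hasSum_binomialSum r hx).mul_left a).unique ?_
  convert (hasSum_binomialSum r hy).mul_right a using 2 with k
  rw [mul_smul_comm, smul_mul_assoc, (h.pow_right k).eq]

theorem transpose_binomialSum (r : ℝ) {x : Matrix (Fin 4) (Fin 4) ℝ} (hx : ‖x‖ < 1)
    (hx' : ‖xᵀ‖ < 1) : (binomialSum r x)ᵀ = binomialSum r xᵀ := by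
  refine (hasSum_binomialSum r hx).matrix_transpose.unique ?_
  simp only [Matrix.transpose_smul, Matrix.transpose_pow]
  exact hasSum_binomialSum r hx'

theorem minkowski_mul_self : minkowski * minkowski = 1 := by
  rw [minkowski, Matrix.diagonal_mul_diagonal, ← Matrix.diagonal_one]
  congr 1
  ext i
  fin_cases i <;> simp

theorem transpose_minkowski : minkowskiᵀ = minkowski :=
  Matrix.diagonal_transpose _

/-- The vielbein `E = Σ_k binom(1/2,k) κ^k (hη)^k` and inverse vielbein
`F = Σ_k binom(−1/2,k) κ^k (ηh)^k` as series in the graviton field: they satisfy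
`E η Eᵀ = η + κ h` and `(η + κ h) (F η Fᵀ) = 1`. -/
theorem vielbein_series
    (h : Matrix (Fin 4) (Fin 4) ℝ) (hsymm : hᵀ = h) (κ : ℝ)
    (hbound₁ : |κ| * ‖h * minkowski‖ < 1)
    (hbound₂ : |κ| * ‖minkowski * h‖ < 1) :
    ∃ E F : Matrix (Fin 4) (Fin 4) ℝ,
      HasSum (fun k : ℕ => (gbinom (1 / 2) k * κ ^ k) • (h * minkowski) ^ k) E ∧
      HasSum (fun k : ℕ => (gbinom (-(1 / 2)) k * κ ^ k) • (minkowski * h) ^ k) F ∧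
      E * minkowski * Eᵀ = minkowski + κ • h ∧
      (minkowski + κ • h) * (F * minkowski * Fᵀ) = 1 := by
  have hx : ‖κ • (h * minkowski)‖ < 1 := by rwa [norm_smul]
  have hy : ‖κ • (minkowski * h)‖ < 1 := by rwa [norm_smul]
  have hxy : (κ • (h * minkowski))ᵀ = κ • (minkowski * h) := by
    rw [Matrix.transpose_smul, Matrix.transpose_mul, hsymm, transpose_minkowski]
  have hyx : (κ • (minkowski * h))ᵀ = κ • (h * minkowski) := by
    rw [← hxy, Matrix.transpose_transpose]
  have hη := minkowski_mul_self
  have hsemi₁ : SemiconjBy minkowski (κ • (minkowski * h)) (κ • (h * minkowski)) := by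
    rw [SemiconjBy, mul_smul_comm, smul_mul_assoc, ← mul_assoc, hη, mul_assoc, hη, one_mul, mul_one]
  have hsemi₂ : SemiconjBy minkowski (κ • (h * minkowski)) (κ • (minkowski * h)) := by
    rw [SemiconjBy, mul_smul_comm, smul_mul_assoc, mul_assoc]
  refine ⟨binomialSum (1 / 2) (κ • (h * minkowski)), binomialSum (-(1 / 2)) (κ • (minkowski * h)),
    ?_, ?_, ?_, ?_⟩
  · simp only [gbinom_eq_choose, mul_smul, ← smul_pow]
    exact hasSum_binomialSum (1 / 2) hx
  · simp only [gbinom_eq_choose, mul_smul, ← smul_pow]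
    exact hasSum_binomialSum (-(1 / 2)) hy
  · rw [transpose_binomialSum _ hx (hxy ▸ hy), hxy, mul_assoc,
      (hsemi₁.binomialSum _ hy hx).eq, ← mul_assoc, ← binomialSum_add _ _ hx, add_halves,
      binomialSum_one, add_mul, one_mul, smul_mul_assoc, mul_assoc, hη, mul_one]
  · have hfac : minkowski + κ • h = minkowski * binomialSum 1 (κ • (minkowski * h)) := by
      rw [binomialSum_one, mul_add, mul_one, mul_smul_comm, ← mul_assoc, hη, one_mul]
    rw [transpose_binomialSum _ hy (hyx ▸ hx), hyx, mul_assoc (binomialSum _ _),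
      (hsemi₂.binomialSum _ hx hy).eq, ← mul_assoc (binomialSum _ _), ← binomialSum_add _ _ hy,
      hfac, mul_assoc, ← mul_assoc (binomialSum _ _), ← binomialSum_add _ _ hy,
      show (1 : ℝ) + (-(1 / 2) + -(1 / 2)) = 0 by norm_num, binomialSum_zero, one_mul, hη]
end

section
/- Let g : (Fin 4 → ℝ) → Matrix (Fin 4) (Fin 4) ℝ be twice continuously differentiable, with (g x)ᵀ = g x and g x invertible for every x, and let G x := (g x)⁻¹. Fix x, and write D μ ν ρ for the partial derivative in the μ-th coordinate direction of the (ν,ρ)-entry of g at x, and D2 μ ν ρ σ for the second partial derivative in the μ-th then ν-th coordinate directions of the (ρ,σ)-entry of g at x. Define the Christoffel symbols Γ : (Fin 4 → ℝ) → Fin 4 → Fin 4 → Fin 4 → ℝ by Γ y ρ μ ν := (1/2) Σ_σ (G y) ρ σ * (∂_μ g_{σν}(y) + ∂_ν g_{μσ}(y) − ∂_σ g_{μν}(y)). Then the Ricci scalar R := Σ_{ν,σ} (G x) ν σ * (∂_μ (Γ · μ ν σ)(x) − ∂_ν (Γ · μ μ σ)(x) + Σ_{μ,κ} ((Γ x μ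 μ κ)·(Γ x κ ν σ) − (Γ x μ ν κ)·(Γ x κ μ σ))) (with the derivative terms also summed over μ) equals Σ_{μ,ρ,ν,σ} (G x) μ ρ * (G x) ν σ * (D2 μ ν ρ σ − D2 μ ρ ν σ) + Σ_{μ,ρ,ν,σ,κ,λ} (G x) μ ρ * (G x) ν σ * (G x) κ λ * ( D μ κ λ * (D ν ρ σ − (1/4)·D ρ ν σ) + D ν ρ κ * ((3/4)·D σ μ λ − (1/2)·D μ σ λ) − D μ ρ κ * D ν σ λ ). -/
open BigOperators Matrix

attribute [local instance] Matrix.normedAddCommGroup Matrix.normedSpace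

/-- The partial derivative of `f : (Fin 4 → ℝ) → ℝ` in the `μ`-th coordinate direction
at `x`. -/
noncomputable def pd (f : (Fin 4 → ℝ) → ℝ) (μ : Fin 4) (x : Fin 4 → ℝ) : ℝ :=
  fderiv ℝ f x (Pi.single μ 1)

/-- The contraction of three index pairs of a six-index array with a matrix. -/
noncomputable def contract₃ (G : Matrix (Fin 4) (Fin 4) ℝ)
    (F : Fin 4 → Fin 4 → Fin 4 → Fin 4 → Fin 4 → Fin 4 → ℝ) : ℝ :=
  ∑ m, ∑ r, ∑ n, ∑ s, ∑ k, ∑ l, G m r * G n s * G k l * F m r n s k l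

/-- The contraction of two index pairs of a four-index array with a matrix. -/
noncomputable def contract₂ (G : Matrix (Fin 4) (Fin 4) ℝ)
    (F : Fin 4 → Fin 4 → Fin 4 → Fin 4 → ℝ) : ℝ :=
  ∑ m, ∑ r, ∑ n, ∑ s, G m r * G n s * F m r n s

section Contraction

variable {G : Matrix (Fin 4) (Fin 4) ℝ}

lemma contract₃_add (F H : Fin 4 → Fin 4 → Fin 4 → Fin 4 → Fin 4 → Fin 4 → ℝ) :
    contract₃ G (fun m r n s k l => F m r n s k l + H m r n s k l)
      = contract₃ G F + contract₃ G H := by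
  simp only [contract₃, mul_add, Finset.sum_add_distrib]

lemma contract₃_sub (F H : Fin 4 → Fin 4 → Fin 4 → Fin 4 → Fin 4 → Fin 4 → ℝ) :
    contract₃ G (fun m r n s k l => F m r n s k l - H m r n s k l)
      = contract₃ G F - contract₃ G H := by
  simp only [contract₃, mul_sub, Finset.sum_sub_distrib]

lemma contract₃_const_mul (c : ℝ) (F : Fin 4 → Fin 4 → Fin 4 → Fin 4 → Fin 4 → Fin 4 → ℝ) :
    contract₃ G (fun m r n s k l => c * F m r n s k l) = c * contract₃ G F := by
  simp only [contract₃, Finset.mul_sum, mul_left_comm c]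

lemma sum_pair_comm (f : Fin 4 → Fin 4 → Fin 4 → Fin 4 → ℝ) :
    ∑ m, ∑ r, ∑ n, ∑ s, f m r n s = ∑ m, ∑ r, ∑ n, ∑ s, f n s m r := by
  calc
    _ = ∑ m, ∑ n, ∑ r, ∑ s, f m r n s := Finset.sum_congr rfl fun _ _ => Finset.sum_comm
    _ = ∑ n, ∑ m, ∑ r, ∑ s, f m r n s := Finset.sum_comm
    _ = ∑ n, ∑ m, ∑ s, ∑ r, f m r n s :=
      Finset.sum_congr rfl fun _ _ => Finset.sum_congr rfl fun _ _ => Finset.sum_comm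
    _ = ∑ n, ∑ s, ∑ m, ∑ r, f m r n s := Finset.sum_congr rfl fun _ _ => Finset.sum_comm

lemma contract₃_exch₁₂ (F : Fin 4 → Fin 4 → Fin 4 → Fin 4 → Fin 4 → Fin 4 → ℝ) :
    contract₃ G F = contract₃ G (fun m r n s k l => F n s m r k l) := by
  unfold contract₃
  rw [sum_pair_comm]
  simp only [mul_comm (G _ _) (G _ _)]

lemma contract₃_exch₂₃ (F : Fin 4 → Fin 4 → Fin 4 → Fin 4 → Fin 4 → Fin 4 → ℝ) :
    contract₃ G F = contract₃ G (fun m r n s k l => F m r k l n s) := by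
  unfold contract₃
  refine Finset.sum_congr rfl fun m _ => Finset.sum_congr rfl fun r _ => ?_
  rw [sum_pair_comm]
  simp only [mul_right_comm]

lemma contract₃_exch₁₃ (F : Fin 4 → Fin 4 → Fin 4 → Fin 4 → Fin 4 → Fin 4 → ℝ) :
    contract₃ G F = contract₃ G (fun m r n s k l => F k l n s m r) := by
  rw [contract₃_exch₁₂, contract₃_exch₂₃, contract₃_exch₁₂]

lemma contract₃_swap₁ (hG : ∀ a b, G a b = G b a)
    (F : Fin 4 → Fin 4 → Fin 4 → Fin 4 → Fin 4 → Fin 4 → ℝ) :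
    contract₃ G F = contract₃ G (fun m r n s k l => F r m n s k l) := by
  unfold contract₃
  rw [Finset.sum_comm]
  refine Finset.sum_congr rfl fun m _ => Finset.sum_congr rfl fun r _ => ?_
  rw [hG]

lemma contract₃_swap₂ (hG : ∀ a b, G a b = G b a)
    (F : Fin 4 → Fin 4 → Fin 4 → Fin 4 → Fin 4 → Fin 4 → ℝ) :
    contract₃ G F = contract₃ G (fun m r n s k l => F m r s n k l) := by
  rw [contract₃_exch₁₂, contract₃_swap₁ hG, contract₃_exch₁₂]

lemma contract₃_swap₃ (hG : ∀ a b, G a b = G b a)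
    (F : Fin 4 → Fin 4 → Fin 4 → Fin 4 → Fin 4 → Fin 4 → ℝ) :
    contract₃ G F = contract₃ G (fun m r n s k l => F m r n s l k) := by
  rw [contract₃_exch₁₃, contract₃_swap₁ hG, contract₃_exch₁₃]

lemma contract₂_add (F H : Fin 4 → Fin 4 → Fin 4 → Fin 4 → ℝ) :
    contract₂ G (fun m r n s => F m r n s + H m r n s) = contract₂ G F + contract₂ G H := by
  simp only [contract₂, mul_add, Finset.sum_add_distrib]

lemma contract₂_sub (F H : Fin 4 → Fin 4 → Fin 4 → Fin 4 → ℝ) :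
    contract₂ G (fun m r n s => F m r n s - H m r n s) = contract₂ G F - contract₂ G H := by
  simp only [contract₂, mul_sub, Finset.sum_sub_distrib]

lemma contract₂_exch (F : Fin 4 → Fin 4 → Fin 4 → Fin 4 → ℝ) :
    contract₂ G F = contract₂ G (fun m r n s => F n s m r) := by
  unfold contract₂
  rw [sum_pair_comm]
  simp only [mul_comm (G _ _) (G _ _)]

lemma contract₂_swap₁ (hG : ∀ a b, G a b = G b a) (F : Fin 4 → Fin 4 → Fin 4 → Fin 4 → ℝ) :
    contract₂ G F = contract₂ G (fun m r n s => F r m n s) := by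
  unfold contract₂
  rw [Finset.sum_comm]
  refine Finset.sum_congr rfl fun m _ => Finset.sum_congr rfl fun r _ => ?_
  rw [hG]

lemma contract₂_swap₂ (hG : ∀ a b, G a b = G b a) (F : Fin 4 → Fin 4 → Fin 4 → Fin 4 → ℝ) :
    contract₂ G F = contract₂ G (fun m r n s => F m r s n) := by
  rw [contract₂_exch, contract₂_swap₁ hG, contract₂_exch]

/-- The contribution to the Ricci scalar that is linear in the second derivatives `H` of the
metric. -/
lemma contract₂_second_derivatives (hG : ∀ a b, G a b = G b a)
    {H : Fin 4 → Fin 4 → Fin 4 → Fin 4 → ℝ} (h₁ : ∀ a b c d, H a b c d = H b a c d)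
    (h₂ : ∀ a b c d, H a b c d = H a b d c) :
    contract₂ G (fun m r n s => H m n r s + H m s n r - H m r n s)
        - contract₂ G (fun m r n s => H n m r s + H n s m r - H n r m s)
      = 2 * contract₂ G (fun m r n s => H m n r s - H m r n s) := by
  have e₁ : contract₂ G (fun m r n s => H m s n r) = contract₂ G (fun m r n s => H m n r s) := by
    rw [contract₂_swap₂ hG]; simp only [h₂ _ _ _ _]
  have e₂ : contract₂ G (fun m r n s => H n r m s) = contract₂ G (fun m r n s => H m n r s) := by
    rw [contract₂_swap₁ hG]; simp only [h₁ _ _ _ _]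
  have e₃ : contract₂ G (fun m r n s => H n s m r) = contract₂ G (fun m r n s => H m r n s) :=
    contract₂_exch _
  have e₄ : contract₂ G (fun m r n s => H n m r s) = contract₂ G (fun m r n s => H m n r s) := by
    simp only [h₁ _ _ _ _]
  simp only [contract₂_add, contract₂_sub]
  linarith

/-- The contribution to the Ricci scalar that is quadratic in the first derivatives `D` of the
metric. -/
lemma contract₃_first_derivatives (hG : ∀ a b, G a b = G b a)
    {D : Fin 4 → Fin 4 → Fin 4 → ℝ} (hD : ∀ a b c, D a b c = D a c b) :
    -(1 / 2) * contract₃ G (fun m r n s k l => D m r k * (D n l s + D s n l - D l n s))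
      + 1 / 2 * contract₃ G (fun m r n s k l => D n r k * (D m l s + D s m l - D l m s))
      + 1 / 4 * contract₃ G (fun m r n s k l =>
          (D m r k + D k m r - D r m k) * (D n l s + D s n l - D l n s))
      - 1 / 4 * contract₃ G (fun m r n s k l =>
          (D n r k + D k n r - D r n k) * (D m l s + D s m l - D l m s))
      = contract₃ G (fun m r n s k l =>
          D m k l * (D n r s - (1 / 4) * D r n s)
            + D n r k * ((3 / 4) * D s m l - (1 / 2) * D m s l) - D m r k * D n s l) := by
  have a₁ : contract₃ G (fun m r n s k l => D m r k * D n l s)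
      = contract₃ G (fun m r n s k l => D m r k * D n s l) := by
    congr! 7; grind
  have a₂ : contract₃ G (fun m r n s k l => D m r k * D s n l)
      = contract₃ G (fun m r n s k l => D m r k * D n s l) := contract₃_swap₂ hG _
  have a₃ : contract₃ G (fun m r n s k l => D m r k * D l n s)
      = contract₃ G (fun m r n s k l => D m k l * D n r s) := by
    rw [contract₃_exch₁₂, contract₃_exch₁₃, contract₃_swap₁ hG]; congr! 7; grind
  have b₁ : contract₃ G (fun m r n s k l => D r m k * D n l s)
      = contract₃ G (fun m r n s k l => D m r k * D n s l) := by
    rw [contract₃_swap₁ hG]; exact a₁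
  have b₂ : contract₃ G (fun m r n s k l => D r m k * D s n l)
      = contract₃ G (fun m r n s k l => D m r k * D n s l) := by
    rw [contract₃_swap₁ hG]; exact a₂
  have b₃ : contract₃ G (fun m r n s k l => D r m k * D l n s)
      = contract₃ G (fun m r n s k l => D m k l * D n r s) := by
    rw [contract₃_swap₁ hG]; exact a₃
  have c₁ : contract₃ G (fun m r n s k l => D k m r * D n l s)
      = contract₃ G (fun m r n s k l => D m k l * D n r s) := contract₃_exch₁₃ _
  have c₂ : contract₃ G (fun m r n s k l => D k m r * D s n l)
      = contract₃ G (fun m r n s k l => D m k l * D n r s) := by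
    rw [contract₃_swap₂ hG, contract₃_exch₁₃]; congr! 7; grind
  have c₃ : contract₃ G (fun m r n s k l => D k m r * D l n s)
      = contract₃ G (fun m r n s k l => D m k l * D r n s) := contract₃_exch₁₃ _
  have d₁ : contract₃ G (fun m r n s k l => D n r k * D m l s)
      = contract₃ G (fun m r n s k l => D n r k * D m s l) := by
    congr! 7; grind
  have d₂ : contract₃ G (fun m r n s k l => D n r k * D l m s)
      = contract₃ G (fun m r n s k l => D n r k * D m s l) := by
    rw [contract₃_exch₁₃, contract₃_swap₁ hG, contract₃_swap₃ hG]; congr! 7; grind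
  have e₁ : contract₃ G (fun m r n s k l => D k n r * D s m l)
      = contract₃ G (fun m r n s k l => D r n k * D s m l) := by
    rw [contract₃_exch₁₃, contract₃_swap₁ hG, contract₃_swap₃ hG]; congr! 7; grind
  have e₂ : contract₃ G (fun m r n s k l => D k n r * D l m s)
      = contract₃ G (fun m r n s k l => D n r k * D s m l) := by
    rw [contract₃_exch₂₃]; congr! 7; grind
  have e₃ : contract₃ G (fun m r n s k l => D r n k * D m l s)
      = contract₃ G (fun m r n s k l => D n r k * D s m l) := by
    rw [contract₃_exch₁₂, contract₃_swap₂ hG, contract₃_swap₁ hG]; congr! 7; grind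
  have e₄ : contract₃ G (fun m r n s k l => D k n r * D m l s)
      = contract₃ G (fun m r n s k l => D n r k * D m s l) := by
    rw [contract₃_exch₂₃]; congr! 7; grind
  have e₅ : contract₃ G (fun m r n s k l => D r n k * D l m s)
      = contract₃ G (fun m r n s k l => D n r k * D m s l) := by
    rw [contract₃_exch₁₃, contract₃_exch₁₂, contract₃_swap₂ hG, contract₃_exch₁₃,
      contract₃_swap₁ hG, contract₃_swap₃ hG]
    congr! 7; grind
  simp only [mul_add, mul_sub, add_mul, sub_mul, mul_left_comm (D _ _ _) (_ / _), contract₃_add,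
    contract₃_sub, contract₃_const_mul]
  linarith

end Contraction

section PartialDerivative

variable {f h : (Fin 4 → ℝ) → ℝ} {x : Fin 4 → ℝ}

lemma pd_add (hf : DifferentiableAt ℝ f x) (hh : DifferentiableAt ℝ h x) (μ : Fin 4) :
    pd (fun y => f y + h y) μ x = pd f μ x + pd h μ x := by
  simp [pd, fderiv_fun_add hf hh]

lemma pd_sub (hf : DifferentiableAt ℝ f x) (hh : DifferentiableAt ℝ h x) (μ : Fin 4) :
    pd (fun y => f y - h y) μ x = pd f μ x - pd h μ x := by
  simp [pd, fderiv_fun_sub hf hh]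

lemma pd_mul (hf : DifferentiableAt ℝ f x) (hh : DifferentiableAt ℝ h x) (μ : Fin 4) :
    pd (fun y => f y * h y) μ x = pd f μ x * h x + f x * pd h μ x := by
  simp [pd, fderiv_fun_mul hf hh]
  ring

lemma pd_const_mul (hf : DifferentiableAt ℝ f x) (c : ℝ) (μ : Fin 4) :
    pd (fun y => c * f y) μ x = c * pd f μ x := by
  simp [pd, fderiv_const_mul hf]

lemma pd_sum {ι : Type*} {s : Finset ι} {F : ι → (Fin 4 → ℝ) → ℝ}
    (hF : ∀ i ∈ s, DifferentiableAt ℝ (F i) x) (μ : Fin 4) :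
    pd (fun y => ∑ i ∈ s, F i y) μ x = ∑ i ∈ s, pd (F i) μ x := by
  simp [pd, fderiv_fun_sum hF]

lemma differentiable_pd (hf : ContDiff ℝ 2 f) (μ : Fin 4) : Differentiable ℝ (pd f μ) := by
  have : Differentiable ℝ (fderiv ℝ f) :=
    (hf.fderiv_right (m := 1) (by norm_num)).differentiable (by norm_num)
  unfold pd
  fun_prop

lemma pd_pd (hf : ContDiff ℝ 2 f) (μ ν : Fin 4) :
    pd (pd f ν) μ x = fderiv ℝ (fderiv ℝ f) x (Pi.single μ 1) (Pi.single ν 1) := by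
  have : Differentiable ℝ (fderiv ℝ f) :=
    (hf.fderiv_right (m := 1) (by norm_num)).differentiable (by norm_num)
  change fderiv ℝ (fun y => fderiv ℝ f y (Pi.single ν 1)) x (Pi.single μ 1) = _
  rw [fderiv_clm_apply (this x) (by fun_prop)]
  simp

lemma pd_comm (hf : ContDiff ℝ 2 f) (μ ν : Fin 4) : pd (pd f ν) μ x = pd (pd f μ) ν x := by
  rw [pd_pd hf, pd_pd hf]
  exact (hf.contDiffAt.isSymmSndFDerivAt (by simp)).eq _ _

lemma differentiableAt_det {M : (Fin 4 → ℝ) → Matrix (Fin 4) (Fin 4) ℝ}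
    (hM : ∀ i j, DifferentiableAt ℝ (fun y => M y i j) x) :
    DifferentiableAt ℝ (fun y => (M y).det) x := by
  simp only [Matrix.det_apply']
  fun_prop

lemma differentiableAt_inv_apply {M : (Fin 4 → ℝ) → Matrix (Fin 4) (Fin 4) ℝ}
    (hM : ∀ i j, DifferentiableAt ℝ (fun y => M y i j) x) (hx : IsUnit (M x)) (i j : Fin 4) :
    DifferentiableAt ℝ (fun y => (M y)⁻¹ i j) x := by
  have hdet : (M x).det ≠ 0 := ((Matrix.isUnit_iff_isUnit_det _).1 hx).ne_zero
  simp only [Matrix.inv_def, Matrix.smul_apply, smul_eq_mul, Ring.inverse_eq_inv',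
    Matrix.adjugate_apply]
  refine ((differentiableAt_det hM).inv hdet).mul (differentiableAt_det fun k l => ?_)
  by_cases hk : k = j <;> simp [Matrix.updateRow_apply, hk, hM]

lemma pd_inv_apply {M : (Fin 4 → ℝ) → Matrix (Fin 4) (Fin 4) ℝ}
    (hM : ∀ i j, DifferentiableAt ℝ (fun y => M y i j) x) (hu : ∀ y, IsUnit (M y))
    (μ a d : Fin 4) :
    pd (fun y => (M y)⁻¹ a d) μ x
      = -∑ b, ∑ c, (M x)⁻¹ a b * pd (fun y => M y b c) μ x * (M x)⁻¹ c d := by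
  have hdet (y) : IsUnit (M y).det := (Matrix.isUnit_iff_isUnit_det _).1 (hu y)
  have hI (i j) := differentiableAt_inv_apply hM (hu x) i j
  let P : Matrix (Fin 4) (Fin 4) ℝ := .of fun i j => pd (fun y => (M y)⁻¹ i j) μ x
  let Q : Matrix (Fin 4) (Fin 4) ℝ := .of fun i j => pd (fun y => M y i j) μ x
  have key : P * M x + (M x)⁻¹ * Q = 0 := by
    ext i j
    have h₁ : (fun y => ∑ k, (M y)⁻¹ i k * M y k j)
        = fun _ => (1 : Matrix (Fin 4) (Fin 4) ℝ) i j := by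
      funext y
      rw [← Matrix.mul_apply, Matrix.nonsing_inv_mul _ (hdet y)]
    have h₂ := pd_sum (s := Finset.univ) (fun k _ => (hI i k).mul (hM k j)) μ
    have h₃ : pd (fun y => ∑ k, (M y)⁻¹ i k * M y k j) μ x = 0 := by
      rw [h₁]; simp [pd]
    simp only [Matrix.add_apply, Matrix.mul_apply, Matrix.zero_apply, P, Q, Matrix.of_apply,
      ← Finset.sum_add_distrib]
    rw [← h₃]
    refine Eq.trans ?_ h₂.symm
    exact Finset.sum_congr rfl fun k _ => (pd_mul (hI i k) (hM k j) μ).symm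
  have hP : P = -((M x)⁻¹ * Q * (M x)⁻¹) := by
    rw [← Matrix.neg_mul, ← eq_neg_of_add_eq_zero_left key, Matrix.mul_assoc,
      Matrix.mul_nonsing_inv _ (hdet x), Matrix.mul_one]
  have := congrFun (congrFun hP a) d
  simp only [P, Q, Matrix.of_apply, Matrix.neg_apply, Matrix.mul_apply, Finset.sum_mul] at this
  rw [this, Finset.sum_comm]

end PartialDerivative

/-- The Ricci scalar of the Levi-Civita connection expressed purely via partial
derivatives of the metric and its inverse. -/
theorem ricci_scalar_levi_civita
    (g : (Fin 4 → ℝ) → Matrix (Fin 4) (Fin 4) ℝ)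
    (hg : ContDiff ℝ 2 g)
    (hsymm : ∀ x, (g x)ᵀ = g x)
    (hunit : ∀ x, IsUnit (g x))
    (G : (Fin 4 → ℝ) → Matrix (Fin 4) (Fin 4) ℝ)
    (hG : ∀ x, G x = (g x)⁻¹)
    (x : Fin 4 → ℝ)
    (D : Fin 4 → Fin 4 → Fin 4 → ℝ)
    (hD : ∀ μ ν ρ, D μ ν ρ = pd (fun y => g y ν ρ) μ x)
    (D2 : Fin 4 → Fin 4 → Fin 4 → Fin 4 → ℝ)
    (hD2 : ∀ μ ν ρ σ, D2 μ ν ρ σ = pd (pd (fun y => g y ρ σ) ν) μ x)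
    (Γ : (Fin 4 → ℝ) → Fin 4 → Fin 4 → Fin 4 → ℝ)
    (hΓ : ∀ y ρ μ ν, Γ y ρ μ ν = (1 / 2) * ∑ σ, G y ρ σ *
      (pd (fun z => g z σ ν) μ y + pd (fun z => g z μ σ) ν y - pd (fun z => g z μ ν) σ y)) :
    ∑ ν, ∑ σ, G x ν σ *
        ((∑ μ, pd (fun y => Γ y μ ν σ) μ x)
          - (∑ μ, pd (fun y => Γ y μ μ σ) ν x)
          + ∑ μ, ∑ κ, (Γ x μ μ κ * Γ x κ ν σ - Γ x μ ν κ * Γ x κ μ σ))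
      = (∑ μ, ∑ ρ, ∑ ν, ∑ σ, G x μ ρ * G x ν σ * (D2 μ ν ρ σ - D2 μ ρ ν σ))
        + ∑ μ, ∑ ρ, ∑ ν, ∑ σ, ∑ κ, ∑ lam, G x μ ρ * G x ν σ * G x κ lam *
            (D μ κ lam * (D ν ρ σ - (1 / 4) * D ρ ν σ)
              + D ν ρ κ * ((3 / 4) * D σ μ lam - (1 / 2) * D μ σ lam)
              - D μ ρ κ * D ν σ lam) := by
  have hg' (a b : Fin 4) : ContDiff ℝ 2 (fun y => g y a b) :=
    contDiff_pi.1 (contDiff_pi.1 hg a) b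
  have hgd (a b : Fin 4) : DifferentiableAt ℝ (fun y => g y a b) x :=
    (hg' a b).differentiable (by norm_num) x
  have hgs (y) (a b : Fin 4) : g y a b = g y b a := congrFun (congrFun (hsymm y) b) a
  have hGs (a b : Fin 4) : G x a b = G x b a := by
    have h := Matrix.transpose_nonsing_inv (g x)
    rw [hsymm, ← hG] at h
    exact congrFun (congrFun h b) a
  have hDs (a b c : Fin 4) : D a b c = D a c b := by
    simp only [hD, hgs _ b c]
  have hH₁ (a b c d : Fin 4) : D2 a b c d = D2 b a c d := by
    rw [hD2, hD2, pd_comm (hg' c d)]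
  have hH₂ (a b c d : Fin 4) : D2 a b c d = D2 a b d c := by
    simp only [hD2, hgs _ c d]
  have hΓx (ρ μ ν : Fin 4) :
      Γ x ρ μ ν = (1 / 2) * ∑ σ, G x ρ σ * (D μ σ ν + D ν μ σ - D σ μ ν) := by
    simp only [hΓ, hD]
  have hGd (a b : Fin 4) : DifferentiableAt ℝ (fun y => G y a b) x := by
    simpa only [hG] using differentiableAt_inv_apply hgd (hunit x) a b
  have hdG (μ a d : Fin 4) :
      pd (fun y => G y a d) μ x = -∑ b, ∑ c, G x a b * D μ b c * G x c d := by
    simpa only [hG, hD] using pd_inv_apply hgd hunit μ a d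
  have hdΓ (α ρ μ ν : Fin 4) : pd (fun y => Γ y ρ μ ν) α x = (1 / 2) * ∑ σ,
      ((-∑ b, ∑ c, G x ρ b * D α b c * G x c σ) * (D μ σ ν + D ν μ σ - D σ μ ν)
        + G x ρ σ * (D2 α μ σ ν + D2 α ν μ σ - D2 α σ μ ν)) := by
    have hp (a b c : Fin 4) : DifferentiableAt ℝ (fun y => pd (fun z => g z a b) c y) x :=
      differentiable_pd (hg' a b) c x
    simp only [hΓ]
    rw [pd_const_mul (by fun_prop), pd_sum (by intros; fun_prop)]
    congr 1
    refine Finset.sum_congr rfl fun σ _ => ?_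
    rw [pd_mul (by fun_prop) (by fun_prop), pd_sub (by fun_prop) (by fun_prop),
      pd_add (by fun_prop) (by fun_prop), hdG]
    simp only [hD, hD2]
  have hdΓ_contract (α β : Fin 4 → Fin 4 → Fin 4) :
      ∑ ν, ∑ σ, G x ν σ * ∑ μ, pd (fun y => Γ y μ (β μ ν) σ) (α μ ν) x
        = 1 / 2 * contract₂ (G x) (fun m r n s =>
            D2 (α m n) (β m n) r s + D2 (α m n) s (β m n) r - D2 (α m n) r (β m n) s)
          - 1 / 2 * contract₃ (G x) (fun m r n s k l =>
            D (α m n) r k * (D (β m n) l s + D s (β m n) l - D l (β m n) s)) := by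
    unfold contract₂ contract₃
    rw [sum_pair_comm, sum_pair_comm fun m r n s => ∑ k, ∑ l, _]
    simp only [hdΓ, Finset.mul_sum, ← Finset.sum_sub_distrib]
    refine Finset.sum_congr rfl fun n _ => Finset.sum_congr rfl fun s _ =>
      Finset.sum_congr rfl fun m _ => ?_
    simp only [mul_add, Finset.sum_add_distrib, Finset.sum_sub_distrib]
    rw [add_comm, sub_eq_add_neg]
    congr 1
    · exact Finset.sum_congr rfl fun r _ => by ring
    · simp only [neg_mul, mul_neg, Finset.sum_neg_distrib, Finset.sum_mul, Finset.mul_sum]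
      rw [Finset.sum_comm]
      refine congrArg Neg.neg (Finset.sum_congr rfl fun r _ => ?_)
      rw [Finset.sum_comm]
      exact Finset.sum_congr rfl fun k _ => Finset.sum_congr rfl fun l _ => by ring
  have hΓΓ_contract (β γ : Fin 4 → Fin 4 → Fin 4) :
      ∑ ν, ∑ σ, G x ν σ * ∑ μ, ∑ κ, Γ x μ (β μ ν) κ * Γ x κ (γ μ ν) σ
        = 1 / 4 * contract₃ (G x) (fun m r n s k l =>
            (D (β m n) r k + D k (β m n) r - D r (β m n) k)
              * (D (γ m n) l s + D s (γ m n) l - D l (γ m n) s)) := by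
    unfold contract₃
    rw [sum_pair_comm]
    simp only [hΓx, Finset.mul_sum, Finset.sum_mul]
    refine Finset.sum_congr rfl fun n _ => Finset.sum_congr rfl fun s _ =>
      Finset.sum_congr rfl fun m _ => ?_
    conv_rhs => rw [Finset.sum_comm]
    refine Finset.sum_congr rfl fun k _ => ?_
    rw [Finset.sum_comm]
    exact Finset.sum_congr rfl fun _ _ => Finset.sum_congr rfl fun _ _ => by ring
  have h₂ := contract₂_second_derivatives hGs hH₁ hH₂
  have h₃ := contract₃_first_derivatives hGs hDs
  have e₁ := hdΓ_contract (fun μ _ => μ) (fun _ ν => ν)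
  have e₂ := hdΓ_contract (fun _ ν => ν) (fun μ _ => μ)
  have e₃ := hΓΓ_contract (fun μ _ => μ) (fun _ ν => ν)
  have e₄ := hΓΓ_contract (fun _ ν => ν) (fun μ _ => μ)
  change _ = contract₂ (G x) (fun m r n s => D2 m n r s - D2 m r n s) + contract₃ (G x)
    (fun m r n s k l => D m k l * (D n r s - (1 / 4) * D r n s)
      + D n r k * ((3 / 4) * D s m l - (1 / 2) * D m s l) - D m r k * D n s l)
  rw [← h₃]
  conv_lhs => simp only [mul_add, mul_sub, Finset.sum_add_distrib, Finset.sum_sub_distrib]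
  rw [e₁, e₂, e₃, e₄]
  linarith
end

section
/- Let G ∈ Matrix (Fin 4) (Fin 4) ℝ with Gᵀ = G, and let D : Fin 4 → Fin 4 → Fin 4 → ℝ satisfy D μ ν ρ = D μ ρ ν for all μ, ν, ρ. Define Γ : Fin 4 → Fin 4 → Fin 4 → ℝ by Γ ρ μ ν := (1/2) Σ_σ G ρ σ * (D μ σ ν + D ν μ σ − D σ μ ν). Then Σ_{ν,σ,μ,κ} G ν σ * (Γ μ μ κ * Γ κ ν σ − Γ μ ν κ * Γ κ μ σ) = Σ_{μ,ρ,ν,σ,κ,λ} G μ ρ * G ν σ * G κ λ * ( D κ μ ρ * ((1/2)·D ν σ λ − (1/4)·D λ ν σ) − D ν μ κ * ((1/2)·D ρ σ λ − (1/4)·D σ ρ λ) ). -/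
open BigOperators Matrix

/-- The full contraction of two three-index arrays, each pair of indices through `G`. -/
def tripleContraction {ι : Type*} [Fintype ι] (G : Matrix ι ι ℝ) (X Y : ι → ι → ι → ℝ) : ℝ :=
  ∑ a, ∑ a', ∑ b, ∑ b', ∑ c, ∑ c', G a a' * G b b' * G c c' * (X a b c * Y a' b' c')

section

variable {ι : Type*} [Fintype ι] (G : Matrix ι ι ℝ)

theorem tripleContraction_eq_sum_prod (X Y : ι → ι → ι → ℝ) :
    tripleContraction G X Y = ∑ p : ι × ι, ∑ q : ι × ι, ∑ r : ι × ι,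
      G p.1 p.2 * G q.1 q.2 * G r.1 r.2 * (X p.1 q.1 r.1 * Y p.2 q.2 r.2) := by
  simp only [tripleContraction, Fintype.sum_prod_type]

theorem tripleContraction_swap_left (X Y : ι → ι → ι → ℝ) :
    tripleContraction G (fun a b c => X b a c) (fun a b c => Y b a c)
      = tripleContraction G X Y := by
  simp only [tripleContraction_eq_sum_prod]
  rw [Finset.sum_comm]
  refine Finset.sum_congr rfl fun p _ => Finset.sum_congr rfl fun q _ =>
    Finset.sum_congr rfl fun r _ => ?_
  ring

theorem tripleContraction_swap_right (X Y : ι → ι → ι → ℝ) :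
    tripleContraction G (fun a b c => X a c b) (fun a b c => Y a c b)
      = tripleContraction G X Y := by
  simp only [tripleContraction_eq_sum_prod]
  refine Finset.sum_congr rfl fun p _ => ?_
  rw [Finset.sum_comm]
  refine Finset.sum_congr rfl fun q _ => Finset.sum_congr rfl fun r _ => ?_
  ring

theorem tripleContraction_add_left (X X' Y : ι → ι → ι → ℝ) :
    tripleContraction G (X + X') Y = tripleContraction G X Y + tripleContraction G X' Y := by
  simp only [tripleContraction, ← Finset.sum_add_distrib, Pi.add_apply, add_mul, mul_add]

theorem tripleContraction_sub_left (X X' Y : ι → ι → ι → ℝ) :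
    tripleContraction G (X - X') Y = tripleContraction G X Y - tripleContraction G X' Y := by
  simp only [tripleContraction, ← Finset.sum_sub_distrib, Pi.sub_apply, sub_mul, mul_sub]

theorem tripleContraction_add_right (X Y Y' : ι → ι → ι → ℝ) :
    tripleContraction G X (Y + Y') = tripleContraction G X Y + tripleContraction G X Y' := by
  simp only [tripleContraction, ← Finset.sum_add_distrib, Pi.add_apply, mul_add]

theorem tripleContraction_sub_right (X Y Y' : ι → ι → ι → ℝ) :
    tripleContraction G X (Y - Y') = tripleContraction G X Y - tripleContraction G X Y' := by
  simp only [tripleContraction, ← Finset.sum_sub_distrib, Pi.sub_apply, mul_sub]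

variable {D Γ : ι → ι → ι → ℝ}

/-- The contraction of two Christoffel brackets reduces to the two independent contractions
of `D` with itself. -/
theorem tripleContraction_christoffel (hD : ∀ μ ν ρ, D μ ν ρ = D μ ρ ν) :
    tripleContraction G (fun a b c => D b a c + D c b a - D a b c)
        (fun a b c => D a c b + D b a c - D c a b)
      = 2 * tripleContraction G (fun a b c => D b a c) D
        - tripleContraction G (fun a b c => D b a c) (fun a b c => D b a c) := by
  set T₂ : ι → ι → ι → ℝ := fun a b c => D b a c with hT₂
  set T₃ : ι → ι → ι → ℝ := fun a b c => D c a b with hT₃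
  have hX : (fun a b c => D b a c + D c b a - D a b c) = T₂ + T₃ - D := by
    funext a b c
    simp [hT₂, hT₃, hD c b a]
  have hY : (fun a b c => D a c b + D b a c - D c a b) = D + T₂ - T₃ := by
    funext a b c
    simp [hT₂, hT₃, hD a c b]
  have h₁ : (fun a b c => D a c b) = D := by
    funext a b c
    exact hD a c b
  have h₃ : (fun a b c => T₃ b a c) = T₃ := by
    funext a b c
    exact hD c b a
  have e₁₁ : tripleContraction G T₂ T₂ = tripleContraction G D D :=
    tripleContraction_swap_left G D D
  have e₂₁ : tripleContraction G T₂ D = tripleContraction G D T₂ :=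
    tripleContraction_swap_left G D T₂
  have e₃₃ : tripleContraction G T₃ T₃ = tripleContraction G T₂ T₂ :=
    tripleContraction_swap_right G T₂ T₂
  have e₁₃ : tripleContraction G D T₃ = tripleContraction G D T₂ := by
    have h := tripleContraction_swap_right G D T₂
    rwa [h₁] at h
  have e₃₁ : tripleContraction G T₃ D = tripleContraction G T₂ D := by
    have h := tripleContraction_swap_right G T₂ D
    rwa [h₁] at h
  have e₂₃ : tripleContraction G T₂ T₃ = tripleContraction G D T₃ := by
    have h := tripleContraction_swap_left G D T₃
    rwa [h₃] at h
  have e₃₂ : tripleContraction G T₃ T₂ = tripleContraction G T₃ D := by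
    have h := tripleContraction_swap_left G T₃ D
    rwa [h₃] at h
  rw [hX, hY]
  simp only [tripleContraction_add_left, tripleContraction_sub_left,
    tripleContraction_add_right, tripleContraction_sub_right]
  linarith

/-- The trace of the Christoffel symbol, `Γ^μ_{μκ} = ½ g^{μρ} ∂_κ g_{μρ}`. -/
theorem christoffel_trace (hG : Gᵀ = G)
    (hΓ : ∀ ρ μ ν, Γ ρ μ ν = (1 / 2) * ∑ σ, G ρ σ * (D μ σ ν + D ν μ σ - D σ μ ν)) (κ : ι) :
    ∑ μ, Γ μ μ κ = (1 / 2) * ∑ μ, ∑ ρ, G μ ρ * D κ μ ρ := by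
  have hs : ∑ μ, ∑ ρ, G μ ρ * D μ ρ κ = ∑ μ, ∑ ρ, G μ ρ * D ρ μ κ := by
    rw [Finset.sum_comm]
    refine Finset.sum_congr rfl fun μ _ => Finset.sum_congr rfl fun ρ _ => ?_
    rw [show G ρ μ = G μ ρ from congrFun (congrFun hG μ) ρ]
  simp only [hΓ, ← Finset.mul_sum, mul_sub, mul_add, Finset.sum_sub_distrib,
    Finset.sum_add_distrib]
  linarith

/-- The trace of the Christoffel symbol over its lower indices. -/
theorem christoffel_contract_lower (hG : Gᵀ = G) (hD : ∀ μ ν ρ, D μ ν ρ = D μ ρ ν)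
    (hΓ : ∀ ρ μ ν, Γ ρ μ ν = (1 / 2) * ∑ σ, G ρ σ * (D μ σ ν + D ν μ σ - D σ μ ν)) (κ : ι) :
    ∑ ν, ∑ σ, G ν σ * Γ κ ν σ
      = ∑ ν, ∑ σ, ∑ l, G ν σ * G κ l * (D ν σ l - (1 / 2) * D l ν σ) := by
  have hs : ∑ ν, ∑ σ, ∑ l, G ν σ * G κ l * D ν l σ = ∑ ν, ∑ σ, ∑ l, G ν σ * G κ l * D σ ν l := by
    rw [Finset.sum_comm]
    refine Finset.sum_congr rfl fun ν _ => Finset.sum_congr rfl fun σ _ =>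
      Finset.sum_congr rfl fun l _ => ?_
    rw [show G σ ν = G ν σ from congrFun (congrFun hG ν) σ, hD σ l ν]
  have hs' : ∑ ν, ∑ σ, G ν σ * Γ κ ν σ
      = (1 / 2) * (∑ ν, ∑ σ, ∑ l, G ν σ * G κ l * D ν l σ
        + ∑ ν, ∑ σ, ∑ l, G ν σ * G κ l * D σ ν l - ∑ ν, ∑ σ, ∑ l, G ν σ * G κ l * D l ν σ) := by
    simp only [hΓ, Finset.mul_sum, ← Finset.sum_add_distrib, ← Finset.sum_sub_distrib]
    refine Finset.sum_congr rfl fun ν _ => Finset.sum_congr rfl fun σ _ =>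
      Finset.sum_congr rfl fun l _ => ?_
    ring
  rw [hs', ← hs]
  simp only [Finset.mul_sum, ← Finset.sum_add_distrib, ← Finset.sum_sub_distrib]
  refine Finset.sum_congr rfl fun ν _ => Finset.sum_congr rfl fun σ _ =>
    Finset.sum_congr rfl fun l _ => ?_
  rw [hD ν l σ]
  ring

theorem sum_christoffel_trace_mul (hG : Gᵀ = G) (hD : ∀ μ ν ρ, D μ ν ρ = D μ ρ ν)
    (hΓ : ∀ ρ μ ν, Γ ρ μ ν = (1 / 2) * ∑ σ, G ρ σ * (D μ σ ν + D ν μ σ - D σ μ ν)) :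
    ∑ ν, ∑ σ, ∑ μ, ∑ κ, G ν σ * (Γ μ μ κ * Γ κ ν σ)
      = ∑ μ, ∑ ρ, ∑ ν, ∑ σ, ∑ κ, ∑ l, G μ ρ * G ν σ * G κ l *
          (D κ μ ρ * ((1 / 2) * D ν σ l - (1 / 4) * D l ν σ)) := by
  calc ∑ ν, ∑ σ, ∑ μ, ∑ κ, G ν σ * (Γ μ μ κ * Γ κ ν σ)
      = ∑ p : ι × ι, ∑ κ, ∑ μ, G p.1 p.2 * (Γ μ μ κ * Γ κ p.1 p.2) := by
        simp only [Fintype.sum_prod_type]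
        refine Finset.sum_congr rfl fun ν _ => Finset.sum_congr rfl fun σ _ => Finset.sum_comm
    _ = ∑ κ, (∑ μ, Γ μ μ κ) * ∑ ν, ∑ σ, G ν σ * Γ κ ν σ := by
        rw [Finset.sum_comm]
        refine Finset.sum_congr rfl fun κ _ => ?_
        rw [← Fintype.sum_prod_type' (fun ν σ => G ν σ * Γ κ ν σ), Finset.sum_mul_sum,
          Finset.sum_comm]
        refine Finset.sum_congr rfl fun μ _ => Finset.sum_congr rfl fun p _ => ?_
        ring
    _ = ∑ κ, ∑ p : ι × ι, ∑ q : ι × ι, ∑ l, G p.1 p.2 * G q.1 q.2 * G κ l *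
          (D κ p.1 p.2 * ((1 / 2) * D q.1 q.2 l - (1 / 4) * D l q.1 q.2)) := by
        refine Finset.sum_congr rfl fun κ _ => ?_
        rw [christoffel_trace G hG hΓ, christoffel_contract_lower G hG hD hΓ,
          ← Fintype.sum_prod_type' (fun μ ρ => G μ ρ * D κ μ ρ),
          ← Fintype.sum_prod_type'
            (fun ν σ => ∑ l, G ν σ * G κ l * (D ν σ l - (1 / 2) * D l ν σ)),
          mul_assoc, Finset.sum_mul_sum, Finset.mul_sum]
        refine Finset.sum_congr rfl fun p _ => ?_
        rw [Finset.mul_sum]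
        refine Finset.sum_congr rfl fun q _ => ?_
        rw [Finset.mul_sum, Finset.mul_sum]
        refine Finset.sum_congr rfl fun l _ => ?_
        ring
    _ = ∑ p : ι × ι, ∑ q : ι × ι, ∑ κ, ∑ l, G p.1 p.2 * G q.1 q.2 * G κ l *
          (D κ p.1 p.2 * ((1 / 2) * D q.1 q.2 l - (1 / 4) * D l q.1 q.2)) := by
        rw [Finset.sum_comm]
        exact Finset.sum_congr rfl fun p _ => Finset.sum_comm
    _ = _ := by simp only [Fintype.sum_prod_type]

theorem sum_christoffel_mul_christoffel (hG : Gᵀ = G)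
    (hΓ : ∀ ρ μ ν, Γ ρ μ ν = (1 / 2) * ∑ σ, G ρ σ * (D μ σ ν + D ν μ σ - D σ μ ν)) :
    ∑ ν, ∑ σ, ∑ μ, ∑ κ, G ν σ * (Γ μ ν κ * Γ κ μ σ)
      = (1 / 4) * tripleContraction G (fun a b c => D b a c + D c b a - D a b c)
        (fun a b c => D a c b + D b a c - D c a b) := by
  rw [← Fintype.sum_prod_type' (fun ν σ => ∑ μ, ∑ κ, G ν σ * (Γ μ ν κ * Γ κ μ σ)),
    tripleContraction_eq_sum_prod]
  conv_rhs => rw [Finset.sum_comm, Finset.mul_sum]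
  refine Finset.sum_congr rfl fun q _ => ?_
  simp only [Fintype.sum_prod_type]
  conv_rhs => rw [Finset.sum_comm, Finset.mul_sum]
  refine Finset.sum_congr rfl fun μ _ => ?_
  conv_rhs => rw [Finset.sum_comm, Finset.mul_sum]
  refine Finset.sum_congr rfl fun κ _ => ?_
  rw [hΓ, hΓ, mul_mul_mul_comm, Finset.sum_mul_sum]
  simp only [Finset.mul_sum]
  refine Finset.sum_congr rfl fun ρ _ => Finset.sum_congr rfl fun l _ => ?_
  rw [show G ρ μ = G μ ρ from congrFun (congrFun hG μ) ρ]
  ring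

end

/-- The quadratic part `R^{Γ²} = g^{νσ}(Γ^μ_{μκ} Γ^κ_{νσ} − Γ^μ_{νκ} Γ^κ_{μσ})` of the
Ricci scalar as a pointwise algebraic identity. -/
theorem ricci_scalar_quadratic_part
    (G : Matrix (Fin 4) (Fin 4) ℝ) (hG : Gᵀ = G)
    (D : Fin 4 → Fin 4 → Fin 4 → ℝ) (hD : ∀ μ ν ρ, D μ ν ρ = D μ ρ ν)
    (Γ : Fin 4 → Fin 4 → Fin 4 → ℝ)
    (hΓ : ∀ ρ μ ν, Γ ρ μ ν = (1 / 2) * ∑ σ, G ρ σ * (D μ σ ν + D ν μ σ - D σ μ ν)) :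
    ∑ ν, ∑ σ, ∑ μ, ∑ κ, G ν σ * (Γ μ μ κ * Γ κ ν σ - Γ μ ν κ * Γ κ μ σ)
      = ∑ μ, ∑ ρ, ∑ ν, ∑ σ, ∑ κ, ∑ lam, G μ ρ * G ν σ * G κ lam *
          (D κ μ ρ * ((1 / 2) * D ν σ lam - (1 / 4) * D lam ν σ)
            - D ν μ κ * ((1 / 2) * D ρ σ lam - (1 / 4) * D σ ρ lam)) := by
  have hQ := tripleContraction_christoffel G hD
  have hB := sum_christoffel_mul_christoffel G hG hΓ
  simp only [mul_sub (G _ _), Finset.sum_sub_distrib]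
  rw [sum_christoffel_trace_mul G hG hD hΓ, hB, hQ]
  simp only [tripleContraction, Finset.mul_sum, ← Finset.sum_sub_distrib]
  refine Finset.sum_congr rfl fun μ _ => Finset.sum_congr rfl fun ρ _ =>
    Finset.sum_congr rfl fun ν _ => Finset.sum_congr rfl fun σ _ =>
    Finset.sum_congr rfl fun κ _ => Finset.sum_congr rfl fun l _ => ?_
  ring
end

section
/- Let G ∈ Matrix (Fin 4) (Fin 4) ℝ with Gᵀ = G, and let D : Fin 4 → Fin 4 → Fin 4 → ℝ satisfy D μ ν ρ = D μ ρ ν for all μ, ν, ρ. Define Γ : Fin 4 → Fin 4 → Fin 4 → ℝ by Γ μ ν ρ := (1/2)·(D μ ν ρ + D ν ρ μ − D ρ μ ν), and define dD : Fin 4 → ℝ by dD μ := Σ_{ρ,σ} G ρ σ * Γ ρ σ μ. Then Σ_{μ,ν} G μ ν * dD μ * dD ν = Σ_{μ,ρ,ν,σ,κ,λ} G μ ρ * G ν σ * G κ λ * ( D ν σ μ * D κ λ ρ − D ν σ μ * D ρ κ λ + (1/4)·D μ ν σ * D ρ κ λ ). -/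
open BigOperators Matrix

/-- A product of two double sums is a fourfold sum. -/
theorem double_sum_mul_double_sum {ι R : Type*} [Fintype ι] [NonUnitalNonAssocSemiring R] (f h : ι → ι → R) :
    (∑ ν, ∑ σ, f ν σ) * (∑ κ, ∑ lam, h κ lam) = ∑ ν, ∑ σ, ∑ κ, ∑ lam, f ν σ * h κ lam := by
  simp only [Finset.sum_mul]
  simp only [Finset.mul_sum]

/-- Contracting the Christoffel symbol of the first kind with a symmetric `G`. -/
theorem contracted_christoffel {ι : Type*} [Fintype ι]
    (G : Matrix ι ι ℝ) (hG : Gᵀ = G)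
    (D : ι → ι → ι → ℝ) (hD : ∀ μ ν ρ, D μ ν ρ = D μ ρ ν) (μ : ι) :
    ∑ ρ, ∑ σ, G ρ σ * ((1 / 2) * (D ρ σ μ + D σ μ ρ - D μ ρ σ))
      = ∑ ρ, ∑ σ, G ρ σ * D ρ σ μ - (1 / 2) * ∑ ρ, ∑ σ, G ρ σ * D μ ρ σ := by
  have hswap : ∑ ρ, ∑ σ, G ρ σ * D σ μ ρ = ∑ ρ, ∑ σ, G ρ σ * D ρ σ μ := by
    rw [Finset.sum_comm]
    refine Finset.sum_congr rfl fun σ _ => Finset.sum_congr rfl fun ρ _ => ?_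
    rw [hD σ μ ρ, ← Matrix.transpose_apply G, hG]
  have hsplit : ∑ ρ, ∑ σ, G ρ σ * ((1 / 2) * (D ρ σ μ + D σ μ ρ - D μ ρ σ))
      = (1 / 2) * (∑ ρ, ∑ σ, G ρ σ * D ρ σ μ + ∑ ρ, ∑ σ, G ρ σ * D σ μ ρ
        - ∑ ρ, ∑ σ, G ρ σ * D μ ρ σ) := by
    simp only [← Finset.sum_add_distrib, ← Finset.sum_sub_distrib, Finset.mul_sum]
    refine Finset.sum_congr rfl fun ρ _ => Finset.sum_congr rfl fun σ _ => ?_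
    ring
  rw [hsplit, hswap]
  ring

/-- The metric expression for the square of the de Donder gauge fixing
`dD² = g^{μν} dD_μ dD_ν` with `dD_μ = g^{ρσ} Γ_{ρσμ}`. -/
theorem de_donder_gauge_fixing_square
    (G : Matrix (Fin 4) (Fin 4) ℝ) (hG : Gᵀ = G)
    (D : Fin 4 → Fin 4 → Fin 4 → ℝ) (hD : ∀ μ ν ρ, D μ ν ρ = D μ ρ ν)
    (Γ : Fin 4 → Fin 4 → Fin 4 → ℝ)
    (hΓ : ∀ μ ν ρ, Γ μ ν ρ = (1 / 2) * (D μ ν ρ + D ν ρ μ - D ρ μ ν))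
    (dD : Fin 4 → ℝ)
    (hdD : ∀ μ, dD μ = ∑ ρ, ∑ σ, G ρ σ * Γ ρ σ μ) :
    ∑ μ, ∑ ν, G μ ν * dD μ * dD ν
      = ∑ μ, ∑ ρ, ∑ ν, ∑ σ, ∑ κ, ∑ lam, G μ ρ * G ν σ * G κ lam *
          (D ν σ μ * D κ lam ρ - D ν σ μ * D ρ κ lam + (1 / 4) * D μ ν σ * D ρ κ lam) := by
  set a : Fin 4 → ℝ := fun μ => ∑ ρ, ∑ σ, G ρ σ * D ρ σ μ with ha
  set b : Fin 4 → ℝ := fun μ => ∑ ρ, ∑ σ, G ρ σ * D μ ρ σ with hb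
  have hdD_eq : ∀ μ, dD μ = a μ - (1 / 2) * b μ := fun μ => by
    simp only [hdD, hΓ, contracted_christoffel G hG D hD, ha, hb]
  have hright : ∀ μ ρ, ∑ ν, ∑ σ, ∑ κ, ∑ lam, G μ ρ * G ν σ * G κ lam *
      (D ν σ μ * D κ lam ρ - D ν σ μ * D ρ κ lam + (1 / 4) * D μ ν σ * D ρ κ lam)
      = G μ ρ * (a μ * a ρ - a μ * b ρ + (1 / 4) * (b μ * b ρ)) := fun μ ρ => by
    simp only [ha, hb, double_sum_mul_double_sum]
    simp only [← Finset.sum_add_distrib,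
      ← Finset.sum_sub_distrib, Finset.mul_sum]
    refine Finset.sum_congr rfl fun ν _ => Finset.sum_congr rfl fun σ _ =>
      Finset.sum_congr rfl fun κ _ => Finset.sum_congr rfl fun lam _ => ?_
    ring
  have hcross : ∑ μ, ∑ ρ, G μ ρ * (b μ * a ρ) = ∑ μ, ∑ ρ, G μ ρ * (a μ * b ρ) := by
    rw [Finset.sum_comm]
    refine Finset.sum_congr rfl fun ρ _ => Finset.sum_congr rfl fun μ _ => ?_
    rw [← Matrix.transpose_apply G, hG, mul_comm (b μ)]
  have hdiff : ∑ μ, ∑ ν, G μ ν * dD μ * dD ν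
      - ∑ μ, ∑ ρ, G μ ρ * (a μ * a ρ - a μ * b ρ + (1 / 4) * (b μ * b ρ))
      = (1 / 2) * (∑ μ, ∑ ρ, G μ ρ * (a μ * b ρ) - ∑ μ, ∑ ρ, G μ ρ * (b μ * a ρ)) := by
    simp only [hdD_eq, ← Finset.sum_sub_distrib, Finset.mul_sum]
    refine Finset.sum_congr rfl fun μ _ => Finset.sum_congr rfl fun ρ _ => ?_
    ring
  simp only [hright]
  rw [hcross, sub_self, mul_zero] at hdiff
  exact sub_eq_zero.mp hdiff
end

section
/- Let R be a commutative ring that is a ℚ-algebra, and let a, b, c, d ∈ R. In the formal power series ring R[[X]], define S := a·X + b·X^2 + c·X^3 + d·X^4, and define T ∈ R[[X]] by specifying its m-th coefficient to be Σ_{(i,j,k,l) : i+j+k+l = m, i ≥ j ≥ k ≥ l ≥ 0} binom (1/2) i · choose(i, j) · choose(j, k) · choose(k, l) · a^(i−j) * b^(j−k) * c^(k−l) * d^l, where binom (1/2) i ∈ ℚ acts on R by scalar multiplication and choose denotes the ordinary binomial coefficient. Then T * T = 1 + S. -/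
open BigOperators PowerSeries

/-- The generalized binomial coefficient `binom r k = r(r-1)⋯(r-k+1)/k!` in `ℚ`. -/
def gbinomQ (r : ℚ) (k : ℕ) : ℚ :=
  (∏ i ∈ Finset.range k, (r - i)) / (k.factorial : ℚ)

theorem descPochhammer_smeval_eq_prod_range {R : Type*} [CommRing R] (r : R) (n : ℕ) :
    (descPochhammer ℤ n).smeval r = ∏ i ∈ Finset.range n, (r - i) := by
  induction n with
  | zero => simp
  | succ n ih =>
    simp [descPochhammer_succ_right, Polynomial.smeval_mul, Polynomial.smeval_natCast, ih,
      Finset.prod_range_succ, Polynomial.smeval_sub]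

theorem gbinomQ_eq_choose (r : ℚ) (k : ℕ) : gbinomQ r k = Ring.choose r k := by
  rw [gbinomQ, Ring.choose_eq_smul, descPochhammer_smeval_eq_prod_range, smul_eq_mul,
    div_eq_inv_mul]

theorem add_pow_eq_sum_range_of_lt {A : Type*} [CommSemiring A] (x y : A) {i n : ℕ}
    (hi : i < n) :
    (x + y) ^ i = ∑ j ∈ Finset.range n, (i.choose j : A) * x ^ (i - j) * y ^ j := by
  rw [add_comm, add_pow]
  refine (Finset.sum_congr rfl fun j _ => by ring).trans
    (Finset.sum_subset (Finset.range_mono (Nat.succ_le_of_lt hi)) fun j _ hj => ?_)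
  rw [Nat.choose_eq_zero_of_lt (by simpa [Nat.lt_succ_iff] using hj)]
  simp

theorem quadrinomial_pow {A : Type*} [CommSemiring A] (w x y z : A) {i n : ℕ} (hi : i < n) :
    (w + x + y + z) ^ i =
      ∑ j ∈ Finset.range n, ∑ k ∈ Finset.range n, ∑ l ∈ Finset.range n,
        ((i.choose j * j.choose k * k.choose l : ℕ) : A) *
          (w ^ (i - j) * x ^ (j - k) * y ^ (k - l) * z ^ l) := by
  rw [show w + x + y + z = w + (x + (y + z)) by ring, add_pow_eq_sum_range_of_lt _ _ hi]
  refine Finset.sum_congr rfl fun j hj => ?_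
  rw [add_pow_eq_sum_range_of_lt _ _ (Finset.mem_range.1 hj), Finset.mul_sum]
  refine Finset.sum_congr rfl fun k hk => ?_
  rw [add_pow_eq_sum_range_of_lt _ _ (Finset.mem_range.1 hk), Finset.mul_sum, Finset.mul_sum]
  refine Finset.sum_congr rfl fun l _ => ?_
  push_cast
  ring

theorem coeff_quartic_pow {R : Type*} [CommRing R] (a b c d : R) {i m : ℕ} (hi : i < m + 1) :
    coeff m ((a • (X : PowerSeries R) + b • (X : PowerSeries R) ^ 2
        + c • (X : PowerSeries R) ^ 3 + d • (X : PowerSeries R) ^ 4) ^ i) =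
      ∑ j ∈ Finset.range (m + 1), ∑ k ∈ Finset.range (m + 1), ∑ l ∈ Finset.range (m + 1),
        if i + j + k + l = m ∧ l ≤ k ∧ k ≤ j ∧ j ≤ i then
          ((i.choose j * j.choose k * k.choose l : ℕ) : R) *
            (a ^ (i - j) * b ^ (j - k) * c ^ (k - l) * d ^ l)
        else 0 := by
  rw [quadrinomial_pow _ _ _ _ hi]
  simp only [map_sum]
  refine Finset.sum_congr rfl fun j _ => Finset.sum_congr rfl fun k _ =>
    Finset.sum_congr rfl fun l _ => ?_
  by_cases h : l ≤ k ∧ k ≤ j ∧ j ≤ i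
  · have hX : (X : PowerSeries R) ^ (i - j) * (X ^ 2) ^ (j - k) * (X ^ 3) ^ (k - l) * (X ^ 4) ^ l
        = X ^ (i + j + k + l) := by
      simp only [← pow_mul, ← pow_add]
      congr 1
      omega
    simp only [smul_pow, smul_mul_smul_comm, hX, ← nsmul_eq_mul, map_nsmul, coeff_smul,
      coeff_X_pow, h, and_true, eq_comm (a := m)]
    split_ifs <;> simp
  · rw [if_neg fun h' => h h'.2]
    have h0 : i.choose j * j.choose k * k.choose l = 0 := by
      simp only [mul_eq_zero, Nat.choose_eq_zero_iff]
      omega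
    simp [h0]

theorem binomialSeries_half_mul_self (A : Type*) [Ring A] [Algebra ℚ A] :
    PowerSeries.binomialSeries A (1 / 2 : ℚ) * PowerSeries.binomialSeries A (1 / 2 : ℚ) = 1 + X := by
  rw [← binomialSeries_add, show (1 / 2 + 1 / 2 : ℚ) = (1 : ℕ) by norm_num, binomialSeries_nat,
    pow_one]

theorem coeff_subst_eq_sum_range {R S : Type*} [CommRing R] [CommRing S] [Algebra R S]
    {f : PowerSeries S} (hf : constantCoeff f = 0) (g : PowerSeries R) (m : ℕ) :
    coeff m (g.subst f) = ∑ i ∈ Finset.range (m + 1), coeff i g • coeff m (f ^ i) := by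
  rw [coeff_subst' (.of_constantCoeff_zero' hf)]
  refine finsum_eq_sum_of_support_subset _ fun i hi => ?_
  by_contra hmi
  refine hi ?_
  have hdvd : X ^ i ∣ f ^ i := pow_dvd_pow_of_dvd (X_dvd_iff.2 hf) i
  have hlt : m < i := by simpa [Nat.lt_succ_iff] using hmi
  simp only [X_pow_dvd_iff.1 hdvd m hlt, smul_zero]

/-- The formal square root of `1 + a X + b X² + c X³ + d X⁴`: the power series `T` whose
`m`-th coefficient is
`Σ_{i+j+k+l = m, i ≥ j ≥ k ≥ l} binom(1/2,i) C(i,j) C(j,k) C(k,l) a^{i−j} b^{j−k} c^{k−l} d^l`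
satisfies `T * T = 1 + S`. -/
theorem formal_sqrt_det_series
    (R : Type*) [CommRing R] [Algebra ℚ R]
    (a b c d : R)
    (S : PowerSeries R)
    (hS : S = a • (PowerSeries.X : PowerSeries R) + b • (PowerSeries.X : PowerSeries R) ^ 2
      + c • (PowerSeries.X : PowerSeries R) ^ 3 + d • (PowerSeries.X : PowerSeries R) ^ 4)
    (T : PowerSeries R)
    (hT : T = PowerSeries.mk fun m =>
      ∑ i ∈ Finset.range (m + 1), ∑ j ∈ Finset.range (m + 1),
      ∑ k ∈ Finset.range (m + 1), ∑ l ∈ Finset.range (m + 1),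
        if i + j + k + l = m ∧ l ≤ k ∧ k ≤ j ∧ j ≤ i then
          (gbinomQ (1 / 2) i * (i.choose j : ℚ) * (j.choose k : ℚ) * (k.choose l : ℚ)) •
            (a ^ (i - j) * b ^ (j - k) * c ^ (k - l) * d ^ l)
        else 0) :
    T * T = 1 + S := by
  have hS0 : constantCoeff S = 0 := by simp [hS, smul_eq_C_mul]
  have hsub : HasSubst S := .of_constantCoeff_zero' hS0
  have hTS : T = (PowerSeries.binomialSeries ℚ (1 / 2 : ℚ)).subst S := by
    ext m
    rw [coeff_subst_eq_sum_range hS0, hT, coeff_mk]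
    refine Finset.sum_congr rfl fun i hi => ?_
    rw [hS, coeff_quartic_pow a b c d (Finset.mem_range.1 hi)]
    simp only [Finset.smul_sum]
    refine Finset.sum_congr rfl fun j _ => Finset.sum_congr rfl fun k _ =>
      Finset.sum_congr rfl fun l _ => ?_
    split_ifs
    · rw [binomialSeries_coeff, smul_eq_mul, mul_one, ← gbinomQ_eq_choose, ← nsmul_eq_mul,
        ← Nat.cast_smul_eq_nsmul ℚ, smul_smul]
      push_cast
      simp only [mul_assoc]
    · rw [smul_zero]
  rw [hTS, ← subst_mul hsub, binomialSeries_half_mul_self, subst_add hsub, subst_X hsub,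
    ← coe_substAlgHom hsub, map_one]
end
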